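/- Let 1 ≤ N ≤ 3 and let W : ℝ^N → ℝ be locally integrable, even (W(−x) = W(x) for a.e. x), and belong to M_{2,2}(ℝ^N) and M_{3,3}(ℝ^N). Then for every p ∈ [3/2, 3] there is a constant C_p, depending only on ‖W‖_{2,2} and ‖W‖_{3,3}, such that W ∈ M_{p,p}(ℝ^N) with constant C_p. In particular, W satisfies condition (W_N) with the choice p₁ = q₁ = 3/2, p₂ = p₃ = q₂ = q₃ = s₁ = s₂ = 3, p₄ = q₄ = 2. -/

import Mathlib

open MeasureTheory Filter Complex SchwartzMap Metric
open scoped ENNReal Topology ComplexConjugate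

noncomputable section

/-- Convolution of a real kernel with a complex-valued function. -/
def convW {N : ℕ} (W : (Fin N → ℝ) → ℝ) (f : (Fin N → ℝ) → ℂ) (x : Fin N → ℝ) : ℂ :=
  ∫ y, (W (x - y) : ℂ) * f y

/-- `W ∈ M_{p,q}(ℝ^N)` with constant `K`: for every Schwartz function `f` the convolution
`W∗f` converges absolutely a.e. and `‖W∗f‖_{L^q} ≤ K ‖f‖_{L^p}`. -/
def MemMwith {N : ℕ} (W : (Fin N → ℝ) → ℝ) (p q : ℝ≥0∞) (K : ℝ) : Prop :=
  ∀ f : SchwartzMap (Fin N → ℝ) ℂ,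
    (∀ᵐ x : Fin N → ℝ, Integrable (fun y => (W (x - y) : ℂ) * f y) volume) ∧
    eLpNorm (convW W ⇑f) q volume ≤ ENNReal.ofReal K * eLpNorm (⇑f) p volume

/-- `W ∈ M_{p,q}(ℝ^N)`. -/
def MemM {N : ℕ} (W : (Fin N → ℝ) → ℝ) (p q : ℝ≥0∞) : Prop :=
  ∃ K : ℝ, 0 ≤ K ∧ MemMwith W p q K

/-- Condition `(W_N)` with a given choice of exponents. -/
def CondWnAt {N : ℕ} (W : (Fin N → ℝ) → ℝ)
    (p₁ p₂ p₃ p₄ q₁ q₂ q₃ q₄ s₁ s₂ : ℝ) : Prop :=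
  1 ≤ p₁ ∧ 1 ≤ p₂ ∧ 1 ≤ p₃ ∧ 1 ≤ p₄ ∧ 1 ≤ q₁ ∧ 1 ≤ q₂ ∧ 1 ≤ q₃ ∧ 1 ≤ q₄ ∧
  1 ≤ s₁ ∧ 1 ≤ s₂ ∧
  (3 ≤ N →
    p₄ < (N : ℝ) / ((N : ℝ) - 2) ∧
    2 ≤ p₂ ∧ p₂ < 2 * (N : ℝ) / ((N : ℝ) - 2) ∧
    2 ≤ p₃ ∧ p₃ < 2 * (N : ℝ) / ((N : ℝ) - 2) ∧
    2 ≤ s₁ ∧ s₁ < 2 * (N : ℝ) / ((N : ℝ) - 2) ∧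
    2 ≤ s₂ ∧ s₂ < 2 * (N : ℝ) / ((N : ℝ) - 2) ∧
    2 * (N : ℝ) / ((N : ℝ) + 2) < q₁ ∧ q₁ ≤ 2 ∧
    (N : ℝ) / 2 < q₃ ∧ (N : ℝ) / 2 < q₄) ∧
  (N ≤ 2 → 2 ≤ p₂ ∧ 2 ≤ p₃ ∧ 2 ≤ s₁ ∧ 2 ≤ s₂ ∧ 1 < q₁ ∧ q₁ ≤ 2) ∧
  MemM W 2 2 ∧
  MemM W (ENNReal.ofReal p₁) (ENNReal.ofReal q₁) ∧
  MemM W (ENNReal.ofReal p₂) (ENNReal.ofReal q₂) ∧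
  MemM W (ENNReal.ofReal p₃) (ENNReal.ofReal q₃) ∧
  MemM W (ENNReal.ofReal p₄) (ENNReal.ofReal q₄) ∧
  1 / p₃ + 1 / q₂ = 1 / q₁ ∧ 1 / p₁ - 1 / p₃ = 1 / s₁ ∧ 1 / q₁ - 1 / q₃ = 1 / s₂

/-- Condition `(W_N)`. -/
def CondWn {N : ℕ} (W : (Fin N → ℝ) → ℝ) : Prop :=
  ∃ p₁ p₂ p₃ p₄ q₁ q₂ q₃ q₄ s₁ s₂ : ℝ, CondWnAt W p₁ p₂ p₃ p₄ q₁ q₂ q₃ q₄ s₁ s₂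

/-- Bounded measurable functions supported in a ball. -/
structure IsBddSupp {N : ℕ} (f : (Fin N → ℝ) → ℂ) : Prop where
  measurable : Measurable f
  bdd : ∃ C, 0 ≤ C ∧ ∀ x, ‖f x‖ ≤ C
  supp : ∃ R, ∀ x, R < ‖x‖ → f x = 0

namespace IsBddSupp

variable {N : ℕ} {f g : (Fin N → ℝ) → ℂ}

lemma of_norm_le (hf : IsBddSupp f) (hg : Measurable g) (h0 : ∀ x, f x = 0 → g x = 0)
    (hbdd : ∃ C, 0 ≤ C ∧ ∀ x, ‖g x‖ ≤ C) : IsBddSupp g :=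
  ⟨hg, hbdd, hf.supp.imp fun _ hR x hx => h0 x (hR x hx)⟩

lemma memLp (hf : IsBddSupp f) (p : ℝ≥0∞) : MemLp f p volume := by
  obtain ⟨C, hC0, hC⟩ := hf.bdd
  obtain ⟨R, hR⟩ := hf.supp
  refine (memLp_indicator_const p (measurableSet_closedBall (x := (0 : Fin N → ℝ)) (ε := R)) C
    (Or.inr measure_closedBall_lt_top.ne)).mono hf.measurable.aestronglyMeasurable
    (Eventually.of_forall fun x => ?_)
  by_cases hx : x ∈ closedBall (0 : Fin N → ℝ) R
  · simpa [Set.indicator_of_mem hx, abs_of_nonneg hC0] using hC x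
  · rw [hR x (by simpa using hx)]
    simp

lemma integrable (hf : IsBddSupp f) : Integrable f volume :=
  memLp_one_iff_integrable.1 (hf.memLp 1)

lemma integrable_norm_rpow (hf : IsBddSupp f) {p : ℝ} (hp : 0 < p) :
    Integrable (fun x => ‖f x‖ ^ p) volume := by
  have := (hf.memLp (ENNReal.ofReal p)).integrable_norm_rpow (by simpa using hp) (by simp)
  simpa [ENNReal.toReal_ofReal hp.le] using this

lemma hasCompactSupport (hf : IsBddSupp f) : HasCompactSupport f := by
  obtain ⟨R, hR⟩ := hf.supp
  refine HasCompactSupport.of_support_subset_isCompact (isCompact_closedBall (0 : Fin N → ℝ) R)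
    fun x hx => ?_
  by_contra h
  exact hx (hR x (by simpa using h))

lemma integrable_pairing {W : (Fin N → ℝ) → ℝ} (hW : LocallyIntegrable W volume)
    (hf : IsBddSupp f) (hg : IsBddSupp g) :
    Integrable (fun z : (Fin N → ℝ) × (Fin N → ℝ) => g z.1 * ((W (z.1 - z.2) : ℂ) * f z.2))
      (volume.prod volume) := by
  obtain ⟨R, hR⟩ := hf.supp
  obtain ⟨S, hS⟩ := hg.supp
  obtain ⟨C, hC0, hC⟩ := hg.bdd
  have hV : Integrable ((closedBall (0 : Fin N → ℝ) (S + R)).indicator fun x => (W x : ℂ))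
      volume := by
    rw [integrable_indicator_iff measurableSet_closedBall]
    exact (hW.integrableOn_isCompact (isCompact_closedBall _ _)).ofReal
  have h := (hf.integrable.convolution_integrand (ContinuousLinearMap.mul ℝ ℂ) hV).bdd_mul (c := C)
    (f := fun z : (Fin N → ℝ) × (Fin N → ℝ) => g z.1)
    (hg.measurable.comp measurable_fst).aestronglyMeasurable
    (Eventually.of_forall fun z => hC z.1)
  refine h.congr (Eventually.of_forall fun z => ?_)
  simp only [ContinuousLinearMap.mul_apply']
  by_cases h1 : S < ‖z.1‖
  · simp [hS _ h1]
  by_cases h2 : R < ‖z.2‖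
  · simp [hR _ h2]
  rw [Set.indicator_of_mem, mul_comm (f z.2)]
  rw [mem_closedBall_zero_iff]
  linarith [norm_sub_le z.1 z.2]

lemma integrable_kernel {W : (Fin N → ℝ) → ℝ} (hW : LocallyIntegrable W volume)
    (hf : IsBddSupp f) (x : Fin N → ℝ) :
    Integrable (fun y => (W (x - y) : ℂ) * f y) volume := by
  obtain ⟨R, hR⟩ := hf.supp
  obtain ⟨C, hC0, hC⟩ := hf.bdd
  have hV : Integrable ((closedBall (0 : Fin N → ℝ) (‖x‖ + R)).indicator fun x => (W x : ℂ))
      volume := by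
    rw [integrable_indicator_iff measurableSet_closedBall]
    exact (hW.integrableOn_isCompact (isCompact_closedBall _ _)).ofReal
  have h := (hV.comp_sub_left x).mul_bdd (c := C) hf.measurable.aestronglyMeasurable
    (Eventually.of_forall hC)
  refine h.congr (Eventually.of_forall fun y => ?_)
  by_cases h2 : R < ‖y‖
  · simp [hR _ h2]
  simp only
  rw [Set.indicator_of_mem]
  rw [mem_closedBall_zero_iff]
  linarith [norm_sub_le x y]

lemma integrable_mul_convW {W : (Fin N → ℝ) → ℝ} (hW : LocallyIntegrable W volume)
    (hf : IsBddSupp f) (hg : IsBddSupp g) :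
    Integrable (fun x => g x * convW W f x) volume := by
  simpa only [convW, integral_const_mul] using (integrable_pairing hW hf hg).integral_prod_left

lemma integral_mul_convW_comm {W : (Fin N → ℝ) → ℝ} (hW : LocallyIntegrable W volume)
    (hWeven : ∀ᵐ x : Fin N → ℝ, W (-x) = W x) (hf : IsBddSupp f) (hg : IsBddSupp g) :
    ∫ x, g x * convW W f x = ∫ x, f x * convW W g x := by
  simp only [convW, ← integral_const_mul]
  rw [integral_integral_swap (integrable_pairing hW hf hg)]
  refine integral_congr_ae (Eventually.of_forall fun y => integral_congr_ae ?_)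
  filter_upwards [(quasiMeasurePreserving_sub_left_of_right_invariant volume y).ae hWeven]
    with x hx
  rw [neg_sub] at hx
  rw [hx]
  ring

end IsBddSupp

lemma aestronglyMeasurable_convW {N : ℕ} {W : (Fin N → ℝ) → ℝ} {f : (Fin N → ℝ) → ℂ}
    (hW : AEStronglyMeasurable W volume) (hf : AEStronglyMeasurable f volume) :
    AEStronglyMeasurable (convW W f) volume := by
  have hV : AEStronglyMeasurable (fun x => (W x : ℂ)) volume :=
    continuous_ofReal.comp_aestronglyMeasurable hW
  exact (hf.convolution_integrand (ContinuousLinearMap.mul ℝ ℂ).flip hV).integral_prod_right'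

lemma tendsto_convW {N : ℕ} {W : (Fin N → ℝ) → ℝ} {f : (Fin N → ℝ) → ℂ}
    {u : ℕ → (Fin N → ℝ) → ℂ} {F : (Fin N → ℝ) → ℝ}
    (hW : AEStronglyMeasurable W volume) (hu : ∀ n, AEStronglyMeasurable (u n) volume)
    (huF : ∀ n x, ‖u n x‖ ≤ F x) (hlim : ∀ᵐ x, Tendsto (fun n => u n x) atTop (𝓝 (f x)))
    {x : Fin N → ℝ} (hint : Integrable (fun y => (W (x - y) : ℂ) * F y) volume) :
    Tendsto (fun n => convW W (u n) x) atTop (𝓝 (convW W f x)) := by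
  have hV : AEStronglyMeasurable (fun x => (W x : ℂ)) volume :=
    continuous_ofReal.comp_aestronglyMeasurable hW
  refine tendsto_integral_of_dominated_convergence _ (fun n => ?_) hint.norm (fun n => ?_) ?_
  · exact (hu n).convolution_integrand_snd (ContinuousLinearMap.mul ℝ ℂ).flip hV x
  · refine Eventually.of_forall fun y => ?_
    rw [norm_mul, norm_mul]
    gcongr
    rw [norm_real]
    exact (huF n y).trans (Real.le_norm_self _)
  · filter_upwards [hlim] with y hy using hy.const_mul _

lemma tendsto_eLpNorm_of_dominated {α : Type*} [MeasurableSpace α] {μ : Measure α} {f : α → ℂ}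
    {u : ℕ → α → ℂ} {F : α → ℝ} {p : ℝ} (hp : 0 < p) (hF : MemLp F (ENNReal.ofReal p) μ)
    (hu : ∀ n, AEStronglyMeasurable (u n) μ)
    (huF : ∀ n x, ‖u n x‖ ≤ F x) (hlim : ∀ᵐ x ∂μ, Tendsto (fun n => u n x) atTop (𝓝 (f x))) :
    Tendsto (fun n => eLpNorm (u n) (ENNReal.ofReal p) μ) atTop
      (𝓝 (eLpNorm f (ENNReal.ofReal p) μ)) := by
  have hp0 : ENNReal.ofReal p ≠ 0 := by simpa using hp
  simp only [eLpNorm_eq_lintegral_rpow_enorm_toReal hp0 ENNReal.ofReal_ne_top,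
    ENNReal.toReal_ofReal hp.le]
  refine (ENNReal.continuous_rpow_const.tendsto _).comp
    (tendsto_lintegral_of_dominated_convergence' (fun x => ‖F x‖ₑ ^ p)
      (fun n => (hu n).enorm.pow_const _) (fun n => Eventually.of_forall fun x => ?_) ?_ ?_)
  · have : ‖u n x‖ₑ ≤ ‖F x‖ₑ :=
      enorm_le_iff_norm_le.2 ((huF n x).trans (Real.le_norm_self _))
    exact ENNReal.rpow_le_rpow this hp.le
  · have := lintegral_rpow_enorm_lt_top_of_eLpNorm_lt_top hp0 ENNReal.ofReal_ne_top hF.2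
    rw [ENNReal.toReal_ofReal hp.le] at this
    exact this.ne
  · filter_upwards [hlim] with x hx
    exact (ENNReal.continuous_rpow_const.tendsto _).comp hx.enorm

lemma eLpNorm_convW_le_of_tendsto {N : ℕ} {W : (Fin N → ℝ) → ℝ} {f : (Fin N → ℝ) → ℂ}
    {u : ℕ → (Fin N → ℝ) → ℂ} {F : (Fin N → ℝ) → ℝ} {p K : ℝ} (hp : 0 < p)
    (hW : AEStronglyMeasurable W volume) (hu : ∀ n, AEStronglyMeasurable (u n) volume)
    (hF : MemLp F (ENNReal.ofReal p) volume) (huF : ∀ n x, ‖u n x‖ ≤ F x)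
    (hlim : ∀ᵐ x, Tendsto (fun n => u n x) atTop (𝓝 (f x)))
    (hint : ∀ᵐ x, Integrable (fun y => (W (x - y) : ℂ) * F y) volume)
    (hK : ∀ n, eLpNorm (convW W (u n)) (ENNReal.ofReal p) volume ≤
      ENNReal.ofReal K * eLpNorm (u n) (ENNReal.ofReal p) volume) :
    eLpNorm (convW W f) (ENNReal.ofReal p) volume ≤
      ENNReal.ofReal K * eLpNorm f (ENNReal.ofReal p) volume := by
  have h1 : ∀ᵐ x, Tendsto (fun n => convW W (u n) x) atTop (𝓝 (convW W f x)) := by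
    filter_upwards [hint] with x hx using tendsto_convW hW hu huF hlim hx
  refine (Lp.eLpNorm_lim_le_liminf_eLpNorm
    (fun n => aestronglyMeasurable_convW hW (hu n)) _ h1).trans ?_
  have h2 := ENNReal.Tendsto.const_mul (a := ENNReal.ofReal K)
    (tendsto_eLpNorm_of_dominated hp hF hu huF hlim) (Or.inr ENNReal.ofReal_ne_top)
  exact (liminf_le_liminf (Eventually.of_forall hK)).trans h2.liminf_eq.le

/-- Convolution with `W` is bounded on `L^p`, tested on bounded functions supported in a ball. -/
def ConvBdd {N : ℕ} (W : (Fin N → ℝ) → ℝ) (p K : ℝ) : Prop :=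
  ∀ f : (Fin N → ℝ) → ℂ, IsBddSupp f →
    eLpNorm (convW W f) (ENNReal.ofReal p) volume ≤
      ENNReal.ofReal K * eLpNorm f (ENNReal.ofReal p) volume

lemma MemMwith.convBdd {N : ℕ} {W : (Fin N → ℝ) → ℝ} {p K : ℝ} (hp : 0 < p)
    (hW : LocallyIntegrable W volume)
    (h : MemMwith W (ENNReal.ofReal p) (ENNReal.ofReal p) K) : ConvBdd W p K := by
  intro f hf
  obtain ⟨C, hC0, hC⟩ := hf.bdd
  obtain ⟨R, hR⟩ := hf.supp
  let φ : ℕ → ContDiffBump (0 : Fin N → ℝ) := fun n =>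
    ⟨1 / 2 * (1 / ((n : ℝ) + 1)), 1 / ((n : ℝ) + 1), by positivity, by
      have : 0 < 1 / ((n : ℝ) + 1) := by positivity
      linarith⟩
  have hφ1 : ∀ n, (φ n).rOut ≤ 1 := fun n => by
    change 1 / ((n : ℝ) + 1) ≤ 1
    rw [div_le_one (by positivity)]
    linarith [n.cast_nonneg (α := ℝ)]
  let u : ℕ → (Fin N → ℝ) → ℂ := fun n =>
    convolution ((φ n).normed volume) f (ContinuousLinearMap.lsmul ℝ ℝ) volume
  have hucs : ∀ n, HasCompactSupport (u n) := fun n =>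
    (φ n).hasCompactSupport_normed.convolution _ hf.hasCompactSupport
  have hucd : ∀ n, ContDiff ℝ (⊤ : ℕ∞) (u n) := fun n =>
    (φ n).hasCompactSupport_normed.contDiff_convolution_left _ (φ n).contDiff_normed
      hf.integrable.locallyIntegrable
  have hdist : ∀ n x ε, 0 ≤ ε → (∀ y ∈ ball x 1, ‖f y‖ ≤ ε) → ‖u n x‖ ≤ ε := by
    intro n x ε hε hy
    have := dist_convolution_le (z₀ := (0 : ℂ)) (x₀ := x) hε (φ n).support_normed_eq.subset
      (φ n).nonneg_normed ((φ n).integral_normed (μ := volume))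
      hf.measurable.aestronglyMeasurable
      (fun y hy' => by simpa using hy y (ball_subset_ball (hφ1 n) hy'))
    simpa using this
  let F : (Fin N → ℝ) → ℂ := (closedBall (0 : Fin N → ℝ) (R + 1)).indicator fun _ => (C : ℂ)
  have hF : IsBddSupp F := by
    refine ⟨measurable_const.indicator measurableSet_closedBall, ⟨C, hC0, fun x => ?_⟩,
      ⟨R + 1, fun x hx => Set.indicator_of_notMem (by simpa using hx) _⟩⟩
    refine (norm_indicator_le_norm_self _ _).trans ?_
    simp [abs_of_nonneg hC0]
  have hFnorm : ∀ x, ((‖F x‖ : ℝ) : ℂ) = F x := fun x => by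
    by_cases hx : x ∈ closedBall (0 : Fin N → ℝ) (R + 1)
    · simp [F, Set.indicator_of_mem hx, abs_of_nonneg hC0]
    · simp [F, Set.indicator_of_notMem hx]
  refine eLpNorm_convW_le_of_tendsto (u := u) (F := fun x => ‖F x‖) hp hW.aestronglyMeasurable
    (fun n => (hucd n).continuous.aestronglyMeasurable) (hF.memLp _).norm (fun n x => ?_) ?_ ?_
    (fun n => (h ((hucs n).toSchwartzMap (hucd n))).2)
  · by_cases hx : x ∈ closedBall (0 : Fin N → ℝ) (R + 1)
    · simpa [F, Set.indicator_of_mem hx, abs_of_nonneg hC0] using hdist n x C hC0 fun y _ => hC y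
    · refine (hdist n x 0 le_rfl fun y hy => ?_).trans (norm_nonneg _)
      rw [hR y, norm_zero]
      rw [mem_closedBall_zero_iff, not_le] at hx
      rw [mem_ball'] at hy
      have := norm_sub_norm_le x y
      rw [← dist_eq_norm] at this
      linarith
  · exact ContDiffBump.ae_convolution_tendsto_right_of_locallyIntegrable (K := 2)
      tendsto_one_div_add_atTop_nhds_zero_nat
      (Eventually.of_forall fun n => by
        change 1 / ((n : ℝ) + 1) ≤ 2 * (1 / 2 * (1 / ((n : ℝ) + 1)))
        linarith) hf.integrable.locallyIntegrable
  · refine Eventually.of_forall fun x => ?_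
    simpa only [hFnorm] using hF.integrable_kernel hW x

lemma ConvBdd.memMwith {N : ℕ} {W : (Fin N → ℝ) → ℝ} {p K : ℝ} (hp : 0 < p)
    (hW : LocallyIntegrable W volume) (h : ConvBdd W p K)
    (hint : ∀ f : SchwartzMap (Fin N → ℝ) ℂ,
      ∀ᵐ x : Fin N → ℝ, Integrable (fun y => (W (x - y) : ℂ) * f y) volume) :
    MemMwith W (ENNReal.ofReal p) (ENNReal.ofReal p) K := by
  refine fun f => ⟨hint f, ?_⟩
  have hbound : ∃ C, 0 ≤ C ∧ ∀ x, ‖f x‖ ≤ C :=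
    ⟨_, by positivity, fun x => f.toBoundedContinuousFunction.norm_coe_le_norm x⟩
  let u : ℕ → (Fin N → ℝ) → ℂ := fun n => (closedBall (0 : Fin N → ℝ) n).indicator f
  have huf : ∀ n x, ‖u n x‖ ≤ ‖f x‖ := fun n x => norm_indicator_le_norm_self _ _
  have hu : ∀ n, IsBddSupp (u n) := fun n =>
    ⟨f.continuous.measurable.indicator measurableSet_closedBall,
      hbound.imp fun C hC => ⟨hC.1, fun x => (huf n x).trans (hC.2 x)⟩,
      ⟨n, fun x hx => Set.indicator_of_notMem (by simpa using hx) _⟩⟩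
  refine eLpNorm_convW_le_of_tendsto (u := u) (F := fun x => ‖f x‖) hp hW.aestronglyMeasurable
    (fun n => (hu n).measurable.aestronglyMeasurable) (f.memLp _ _).norm huf
    (Eventually.of_forall fun x => ?_) ?_ (fun n => h _ (hu n))
  · refine tendsto_const_nhds.congr' ?_
    filter_upwards [eventually_ge_atTop ⌈‖x‖⌉₊] with n hn
    exact (Set.indicator_of_mem (by simpa using Nat.ceil_le.1 hn) _).symm
  · have hV : AEStronglyMeasurable (fun x => (W x : ℂ)) volume :=
      continuous_ofReal.comp_aestronglyMeasurable hW.aestronglyMeasurable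
    filter_upwards [hint f] with x hx
    have hm : AEStronglyMeasurable (fun y => (W (x - y) : ℂ) * ((‖f y‖ : ℝ) : ℂ)) volume :=
      (continuous_ofReal.comp f.continuous.norm).aestronglyMeasurable.convolution_integrand_snd
        (ContinuousLinearMap.mul ℝ ℂ).flip hV x
    refine hx.mono hm (Eventually.of_forall fun y => ?_)
    simp

lemma IsBddSupp.eLpNorm_eq {N : ℕ} {f : (Fin N → ℝ) → ℂ} (hf : IsBddSupp f) {p : ℝ}
    (hp : 0 < p) :
    eLpNorm f (ENNReal.ofReal p) volume = ENNReal.ofReal ((∫ x, ‖f x‖ ^ p) ^ (1 / p)) := by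
  rw [(hf.memLp _).eLpNorm_eq_integral_rpow_norm (by simpa using hp) ENNReal.ofReal_ne_top,
    ENNReal.toReal_ofReal hp.le, one_div]

/-- The bilinear form `(f, g) ↦ ∫ g (W ∗ f)` is bounded by `K` times the product of the `L^p` norm
of `f` and the `L^q` norm of `g`. -/
def PairBdd {N : ℕ} (W : (Fin N → ℝ) → ℝ) (p q K : ℝ) : Prop :=
  ∀ f g : (Fin N → ℝ) → ℂ, IsBddSupp f → IsBddSupp g →
    ‖∫ x, g x * convW W f x‖ ≤
      K * ((∫ x, ‖f x‖ ^ p) ^ (1 / p) * (∫ x, ‖g x‖ ^ q) ^ (1 / q))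

lemma PairBdd.symm {N : ℕ} {W : (Fin N → ℝ) → ℝ} {p q K : ℝ} (hW : LocallyIntegrable W volume)
    (hWeven : ∀ᵐ x : Fin N → ℝ, W (-x) = W x) (h : PairBdd W p q K) : PairBdd W q p K := by
  intro f g hf hg
  rw [hf.integral_mul_convW_comm hW hWeven hg, mul_comm (_ ^ (1 / q))]
  exact h g f hg hf

lemma PairBdd.mono {N : ℕ} {W : (Fin N → ℝ) → ℝ} {p q K L : ℝ} (h : PairBdd W p q K)
    (hKL : K ≤ L) : PairBdd W p q L := fun f g hf hg =>
  (h f g hf hg).trans <| mul_le_mul_of_nonneg_right hKL <| mul_nonneg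
    (Real.rpow_nonneg (integral_nonneg fun _ => by positivity) _)
    (Real.rpow_nonneg (integral_nonneg fun _ => by positivity) _)

lemma ConvBdd.pairBdd {N : ℕ} {W : (Fin N → ℝ) → ℝ} {p q K : ℝ} (hpq : p.HolderConjugate q)
    (hK : 0 ≤ K) (hW : LocallyIntegrable W volume) (h : ConvBdd W p K) : PairBdd W p q K := by
  intro f g hf hg
  have hA : 0 ≤ (∫ x, ‖f x‖ ^ p) ^ (1 / p) :=
    Real.rpow_nonneg (integral_nonneg fun _ => by positivity) _
  have hle := h f hf
  rw [hf.eLpNorm_eq hpq.pos, ← ENNReal.ofReal_mul hK] at hle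
  have hmem : MemLp (convW W f) (ENNReal.ofReal p) volume :=
    ⟨aestronglyMeasurable_convW hW.aestronglyMeasurable hf.measurable.aestronglyMeasurable,
      hle.trans_lt ENNReal.ofReal_lt_top⟩
  rw [hmem.eLpNorm_eq_integral_rpow_norm (by simpa using hpq.pos) ENNReal.ofReal_ne_top,
    ENNReal.toReal_ofReal hpq.nonneg, ENNReal.ofReal_le_ofReal_iff (mul_nonneg hK hA),
    ← one_div] at hle
  calc ‖∫ x, g x * convW W f x‖ ≤ ∫ x, ‖convW W f x‖ * ‖g x‖ := by
        refine (norm_integral_le_integral_norm _).trans_eq ?_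
        simp only [norm_mul, mul_comm]
    _ ≤ (∫ x, ‖convW W f x‖ ^ p) ^ (1 / p) * (∫ x, ‖g x‖ ^ q) ^ (1 / q) :=
        integral_mul_norm_le_Lp_mul_Lq hpq hmem (hg.memLp _)
    _ ≤ K * (∫ x, ‖f x‖ ^ p) ^ (1 / p) * (∫ x, ‖g x‖ ^ q) ^ (1 / q) := by
        gcongr
    _ = _ := by ring

/-- Duality: an `L^p` bound follows from testing against bounded functions supported in balls. -/
lemma eLpNorm_le_of_forall_isBddSupp {N : ℕ} {h : (Fin N → ℝ) → ℂ} {p q M : ℝ}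
    (hpq : p.HolderConjugate q) (hM : 0 ≤ M) (hh : AEStronglyMeasurable h volume)
    (hbound : ∀ g : (Fin N → ℝ) → ℂ, IsBddSupp g →
      ‖∫ x, g x * h x‖ ≤ M * (∫ x, ‖g x‖ ^ q) ^ (1 / q)) :
    eLpNorm h (ENNReal.ofReal p) volume ≤ ENNReal.ofReal M := by
  wlog hmeas : Measurable h generalizing h
  · rw [eLpNorm_congr_ae hh.ae_eq_mk]
    refine this hh.stronglyMeasurable_mk.aestronglyMeasurable (fun g hg => ?_)
      hh.stronglyMeasurable_mk.measurable
    convert hbound g hg using 2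
    refine integral_congr_ae ?_
    filter_upwards [hh.ae_eq_mk] with x hx
    rw [hx]
  let A : ℕ → Set (Fin N → ℝ) := fun n => closedBall 0 n ∩ {x | ‖h x‖ ≤ n}
  have hA : ∀ n, MeasurableSet (A n) := fun n =>
    measurableSet_closedBall.inter (measurableSet_le hmeas.norm measurable_const)
  let k : ℕ → (Fin N → ℝ) → ℂ := fun n => (A n).indicator h
  have hk : ∀ n, IsBddSupp (k n) := by
    refine fun n => ⟨hmeas.indicator (hA n), ⟨n, n.cast_nonneg, fun x => ?_⟩,
      ⟨n, fun x hx => Set.indicator_of_notMem (fun hxA => ?_) _⟩⟩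
    · by_cases hx : x ∈ A n
      · simpa [k, Set.indicator_of_mem hx] using hx.2
      · simp [k, Set.indicator_of_notMem hx]
    · have := hxA.1
      rw [mem_closedBall_zero_iff] at this
      linarith
  have hknorm : ∀ n, eLpNorm (k n) (ENNReal.ofReal p) volume ≤ ENNReal.ofReal M := by
    intro n
    rw [(hk n).eLpNorm_eq hpq.pos]
    refine ENNReal.ofReal_le_ofReal ?_
    let g : (Fin N → ℝ) → ℂ := fun x => conj (k n x) * ((‖k n x‖ ^ (p - 2) : ℝ) : ℂ)
    have hgnorm : ∀ x, ‖g x‖ = ‖k n x‖ ^ (p - 1) := by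
      intro x
      rcases eq_or_ne (k n x) 0 with h0 | h0
      · simp [g, h0, Real.zero_rpow hpq.sub_one_ne_zero]
      · have : 0 < ‖k n x‖ := norm_pos_iff.2 h0
        rw [norm_mul, norm_real, RCLike.norm_conj, Real.norm_of_nonneg (by positivity),
          ← Real.rpow_one_add' (by positivity) (by linarith [hpq.sub_one_pos])]
        ring_nf
    have hg : IsBddSupp g := by
      obtain ⟨C, hC0, hC⟩ := (hk n).bdd
      refine (hk n).of_norm_le ?_ (fun x hx => by simp [g, hx]) ⟨C ^ (p - 1), by positivity,
        fun x => ?_⟩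
      · have := (hk n).measurable
        fun_prop
      · rw [hgnorm]
        exact Real.rpow_le_rpow (norm_nonneg _) (hC x) hpq.sub_one_pos.le
    have hgh : ∀ x, g x * h x = ((‖k n x‖ ^ p : ℝ) : ℂ) := by
      intro x
      by_cases hx : x ∈ A n
      · have hkx : k n x = h x := Set.indicator_of_mem hx _
        rw [← hkx]
        rcases eq_or_ne (k n x) 0 with h0 | h0
        · simp [g, h0, Real.zero_rpow hpq.ne_zero]
        · have : 0 < ‖k n x‖ := norm_pos_iff.2 h0
          calc g x * k n x = (conj (k n x) * k n x) * ((‖k n x‖ ^ (p - 2) : ℝ) : ℂ) := by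
                simp only [g]; ring
            _ = ((‖k n x‖ ^ 2 * ‖k n x‖ ^ (p - 2) : ℝ) : ℂ) := by
                rw [conj_mul']; push_cast; ring
            _ = _ := by
                rw [← Real.rpow_natCast, ← Real.rpow_add this]
                norm_num
      · have hkx : k n x = 0 := Set.indicator_of_notMem hx _
        simp [g, hkx, Real.zero_rpow hpq.ne_zero]
    have hgq : ∀ x, ‖g x‖ ^ q = ‖k n x‖ ^ p := by
      intro x
      rw [hgnorm, ← Real.rpow_mul (norm_nonneg _), hpq.sub_one_mul_conj]
    have hI := hbound g hg
    have hI0 : 0 ≤ ∫ x, ‖k n x‖ ^ p := integral_nonneg fun _ => by positivity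
    simp only [hgh, hgq] at hI
    rw [integral_complex_ofReal, norm_real, Real.norm_of_nonneg hI0] at hI
    generalize ∫ x, ‖k n x‖ ^ p = I at hI hI0
    rcases hI0.eq_or_lt with h0 | h0
    · rw [← h0, Real.zero_rpow (one_div_ne_zero hpq.ne_zero)]
      exact hM
    · have hsplit : I ^ (1 / p) * I ^ (1 / q) = I := by
        rw [← Real.rpow_add h0, hpq.one_div_add_one_div, div_one, Real.rpow_one]
      exact le_of_mul_le_mul_right (hsplit.le.trans hI) (Real.rpow_pos_of_pos h0 _)
  refine (Lp.eLpNorm_lim_le_liminf_eLpNorm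
    (fun n => (hk n).measurable.aestronglyMeasurable) h
    (Eventually.of_forall fun x => ?_)).trans ?_
  · refine tendsto_const_nhds.congr' ?_
    filter_upwards [eventually_ge_atTop ⌈‖x‖⌉₊, eventually_ge_atTop ⌈‖h x‖⌉₊] with n hn hn'
    have hx : x ∈ A n := ⟨by simpa using Nat.ceil_le.1 hn, Nat.ceil_le.1 hn'⟩
    exact (Set.indicator_of_mem hx h).symm
  · exact (liminf_le_liminf (Eventually.of_forall hknorm)).trans_eq (liminf_const _)

lemma PairBdd.convBdd {N : ℕ} {W : (Fin N → ℝ) → ℝ} {p q K : ℝ} (hpq : p.HolderConjugate q)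
    (hK : 0 ≤ K) (hW : LocallyIntegrable W volume) (h : PairBdd W p q K) : ConvBdd W p K := by
  intro f hf
  have hA : 0 ≤ (∫ x, ‖f x‖ ^ p) ^ (1 / p) :=
    Real.rpow_nonneg (integral_nonneg fun _ => by positivity) _
  rw [hf.eLpNorm_eq hpq.pos, ← ENNReal.ofReal_mul hK]
  refine eLpNorm_le_of_forall_isBddSupp hpq (mul_nonneg hK hA)
    (aestronglyMeasurable_convW hW.aestronglyMeasurable hf.measurable.aestronglyMeasurable)
    fun g hg => ?_
  rw [mul_assoc]
  exact h f g hf hg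

lemma IsBddSupp.comp_simpleFunc {N : ℕ} {f : SimpleFunc (Fin N → ℝ) ℂ} (hf : IsBddSupp f)
    {φ : ℂ → ℂ} (hφ : φ 0 = 0) : IsBddSupp fun x => φ (f x) := by
  obtain ⟨C, hC⟩ := (f.map φ).exists_forall_norm_le
  exact hf.of_norm_le (f.map φ).measurable (fun x hx => by rw [hx, hφ])
    ⟨max C 0, le_max_right _ _, fun x => (hC x).trans (le_max_left _ _)⟩

/-- The indicator function of `{a} \ {0}`. -/
def punctIndicator (a w : ℂ) : ℂ := if w = a ∧ w ≠ 0 then 1 else 0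

lemma simpleFunc_comp_eq_sum {N : ℕ} (f : SimpleFunc (Fin N → ℝ) ℂ) {φ : ℂ → ℂ} (hφ : φ 0 = 0)
    (x : Fin N → ℝ) : φ (f x) = ∑ a ∈ f.range, φ a * punctIndicator a (f x) := by
  rw [Finset.sum_eq_single_of_mem (f x) (f.mem_range_self x)]
  · by_cases h : f x = 0 <;> simp [punctIndicator, h, hφ]
  · intro b _ hb
    simp [punctIndicator, hb.symm]

lemma integral_simpleFunc_comp_mul_convW {N : ℕ} {W : (Fin N → ℝ) → ℝ}
    (hW : LocallyIntegrable W volume) {f g : SimpleFunc (Fin N → ℝ) ℂ} (hf : IsBddSupp f)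
    (hg : IsBddSupp g) {φ ψ : ℂ → ℂ} (hφ : φ 0 = 0) (hψ : ψ 0 = 0) :
    ∫ x, ψ (g x) * convW W (fun y => φ (f y)) x =
      ∑ b ∈ g.range, ∑ a ∈ f.range, ψ b * φ a *
        ∫ x, punctIndicator b (g x) * convW W (fun y => punctIndicator a (f y)) x := by
  have h0 : ∀ a, punctIndicator a 0 = 0 := fun a => by simp [punctIndicator]
  have hconv : ∀ x, convW W (fun y => φ (f y)) x =
      ∑ a ∈ f.range, φ a * convW W (fun y => punctIndicator a (f y)) x := by
    intro x
    simp only [convW]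
    simp_rw [simpleFunc_comp_eq_sum f hφ, ← integral_const_mul]
    rw [← integral_finsetSum]
    · simp_rw [Finset.mul_sum]
      refine integral_congr_ae (Eventually.of_forall fun y => Finset.sum_congr rfl fun a _ => ?_)
      ring
    · exact fun a _ => ((hf.comp_simpleFunc (h0 a)).integrable_kernel hW x).const_mul _
  simp_rw [hconv, simpleFunc_comp_eq_sum g hψ, ← integral_const_mul, Finset.sum_mul_sum]
  rw [integral_finsetSum]
  · refine Finset.sum_congr rfl fun b _ => ?_
    rw [integral_finsetSum]
    · congr! 3
      ring
    · intro a _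
      refine (((hf.comp_simpleFunc (h0 a)).integrable_mul_convW hW
        (hg.comp_simpleFunc (h0 b))).const_mul (ψ b * φ a)).congr
        (Eventually.of_forall fun x => ?_)
      simp only
      ring
  · intro b _
    refine integrable_finsetSum _ fun a _ => ?_
    refine (((hf.comp_simpleFunc (h0 a)).integrable_mul_convW hW
      (hg.comp_simpleFunc (h0 b))).const_mul (ψ b * φ a)).congr
      (Eventually.of_forall fun x => ?_)
    simp only
    ring

/-- The phase of `w` times `‖w‖ ^ s`, an analytic family in `s`. -/
def phasePow (s w : ℂ) : ℂ := w / ‖w‖ * Complex.exp (s * Real.log ‖w‖)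

@[simp] lemma phasePow_zero (s : ℂ) : phasePow s 0 = 0 := by simp [phasePow]

lemma norm_phasePow (s : ℂ) {w : ℂ} (hw : w ≠ 0) : ‖phasePow s w‖ = ‖w‖ ^ s.re := by
  have : 0 < ‖w‖ := norm_pos_iff.2 hw
  rw [phasePow, norm_mul, norm_div, norm_real, norm_norm, div_self this.ne', one_mul,
    Complex.norm_exp, re_mul_ofReal, Real.rpow_def_of_pos this, mul_comm]

lemma phasePow_one (w : ℂ) : phasePow 1 w = w := by
  rcases eq_or_ne w 0 with rfl | hw
  · simp
  have : 0 < ‖w‖ := norm_pos_iff.2 hw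
  have hne : (‖w‖ : ℂ) ≠ 0 := ofReal_ne_zero.2 this.ne'
  rw [phasePow, one_mul, ← ofReal_exp, Real.exp_log this]
  field_simp

lemma norm_phasePow_rpow {s w : ℂ} {r p : ℝ} (hr : 0 < r) (hp : 0 < p) (hs : s.re = p / r) :
    ‖phasePow s w‖ ^ r = ‖w‖ ^ p := by
  rcases eq_or_ne w 0 with rfl | hw
  · simp [Real.zero_rpow hr.ne', Real.zero_rpow hp.ne']
  · rw [norm_phasePow s hw, ← Real.rpow_mul (norm_nonneg _), hs, div_mul_cancel₀ _ hr.ne']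

lemma norm_phasePow_le {s w : ℂ} {S : ℝ} (h0 : 0 ≤ s.re) (hS : s.re ≤ S) :
    ‖phasePow s w‖ ≤ Real.exp (S * |Real.log ‖w‖|) := by
  rcases eq_or_ne w 0 with rfl | hw
  · simp
  · rw [norm_phasePow s hw, Real.rpow_def_of_pos (norm_pos_iff.2 hw), mul_comm]
    refine Real.exp_le_exp.2 ((mul_le_mul_of_nonneg_left (le_abs_self _) h0).trans ?_)
    gcongr

lemma differentiable_phasePow (w : ℂ) {s : ℂ → ℂ} (hs : Differentiable ℂ s) :
    Differentiable ℂ fun z => phasePow (s z) w := by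
  unfold phasePow
  fun_prop

/-- The affine function of `z` that interpolates between `p / p₀` at `0` and `p / p₁` at `1`. -/
def interpExponent (p p₀ p₁ : ℝ) (z : ℂ) : ℂ := (p / p₀ : ℝ) * (1 - z) + (p / p₁ : ℝ) * z

lemma re_interpExponent (p p₀ p₁ : ℝ) (z : ℂ) :
    (interpExponent p p₀ p₁ z).re = p / p₀ * (1 - z.re) + p / p₁ * z.re := by
  simp only [interpExponent, add_re, re_ofReal_mul, sub_re, one_re]

lemma interp_rpow_mul {A p p₀ p₁ θ : ℝ} (hA : 0 ≤ A) (hp₀ : 0 < p₀) (hp₁ : 0 < p₁)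
    (hθ₀ : 0 ≤ θ) (hθ₁ : θ ≤ 1) (hp : 1 / p = (1 - θ) / p₀ + θ / p₁) :
    (A ^ (1 / p₀)) ^ (1 - θ) * (A ^ (1 / p₁)) ^ θ = A ^ (1 / p) := by
  have : 0 ≤ 1 - θ := sub_nonneg.2 hθ₁
  rw [← Real.rpow_mul hA, ← Real.rpow_mul hA,
    ← Real.rpow_add_of_nonneg hA (by positivity) (by positivity), hp]
  ring_nf

/-- Riesz–Thorin interpolation on simple functions. -/
lemma PairBdd.interpolate_simpleFunc {N : ℕ} {W : (Fin N → ℝ) → ℝ}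
    (hW : LocallyIntegrable W volume) {p q p₀ q₀ p₁ q₁ θ K : ℝ} (hp : 0 < p) (hq : 0 < q)
    (hp₀ : 0 < p₀) (hq₀ : 0 < q₀) (hp₁ : 0 < p₁) (hq₁ : 0 < q₁) (hθ₀ : 0 ≤ θ) (hθ₁ : θ ≤ 1)
    (hpθ : 1 / p = (1 - θ) / p₀ + θ / p₁) (hqθ : 1 / q = (1 - θ) / q₀ + θ / q₁) (hK : 0 ≤ K)
    (h₀ : PairBdd W p₀ q₀ K) (h₁ : PairBdd W p₁ q₁ K) {f g : SimpleFunc (Fin N → ℝ) ℂ}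
    (hf : IsBddSupp f) (hg : IsBddSupp g) :
    ‖∫ x, g x * convW W f x‖ ≤
      K * ((∫ x, ‖f x‖ ^ p) ^ (1 / p) * (∫ x, ‖g x‖ ^ q) ^ (1 / q)) := by
  let s := interpExponent p p₀ p₁
  let t := interpExponent q q₀ q₁
  let G : ℂ → ℂ := fun z =>
    ∫ x, phasePow (t z) (g x) * convW W (fun y => phasePow (s z) (f y)) x
  have hGsum : ∀ z, G z = _ := fun z =>
    integral_simpleFunc_comp_mul_convW hW hf hg (phasePow_zero (s z)) (phasePow_zero (t z))
  have hs : Differentiable ℂ s := by unfold s interpExponent; fun_prop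
  have ht : Differentiable ℂ t := by unfold t interpExponent; fun_prop
  have hGd : Differentiable ℂ G := by
    rw [funext hGsum]
    refine Differentiable.fun_sum fun b _ => Differentiable.fun_sum fun a _ => ?_
    exact ((differentiable_phasePow b ht).mul (differentiable_phasePow a hs)).mul_const _
  have hexp : ∀ {r r₀ r₁ : ℝ}, 0 < r → 0 < r₀ → 0 < r₁ →
      ∀ z ∈ HadamardThreeLines.verticalClosedStrip 0 1, 0 ≤ (interpExponent r r₀ r₁ z).re ∧
        (interpExponent r r₀ r₁ z).re ≤ r / r₀ + r / r₁ := by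
    intro r r₀ r₁ hr hr₀ hr₁ z hz
    obtain ⟨hz0, hz1⟩ : 0 ≤ z.re ∧ z.re ≤ 1 := hz
    have hz' : 0 ≤ 1 - z.re := sub_nonneg.2 hz1
    rw [re_interpExponent]
    refine ⟨by positivity, add_le_add (mul_le_of_le_one_right (by positivity) (by linarith))
      (mul_le_of_le_one_right (by positivity) hz1)⟩
  have hGb : BddAbove ((norm ∘ G) '' HadamardThreeLines.verticalClosedStrip 0 1) := by
    refine ⟨∑ b ∈ g.range, ∑ a ∈ f.range,
      Real.exp ((q / q₀ + q / q₁) * |Real.log ‖b‖|) *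
        Real.exp ((p / p₀ + p / p₁) * |Real.log ‖a‖|) *
        ‖∫ x, punctIndicator b (g x) * convW W (fun y => punctIndicator a (f y)) x‖, ?_⟩
    rintro _ ⟨z, hz, rfl⟩
    rw [Function.comp_apply, hGsum]
    refine norm_sum_le_of_le _ fun b _ => norm_sum_le_of_le _ fun a _ => ?_
    rw [norm_mul, norm_mul]
    have h1 := hexp hp hp₀ hp₁ z hz
    have h2 := hexp hq hq₀ hq₁ z hz
    gcongr
    · exact norm_phasePow_le h2.1 h2.2
    · exact norm_phasePow_le h1.1 h1.2
  have hline : ∀ {r r' : ℝ} (z : ℂ), 0 < r → 0 < r' → (s z).re = p / r → (t z).re = q / r' →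
      PairBdd W r r' K →
      ‖G z‖ ≤ K * ((∫ x, ‖f x‖ ^ p) ^ (1 / r) * (∫ x, ‖g x‖ ^ q) ^ (1 / r')) := by
    intro r r' z hr hr' hsr htr hb
    have := hb _ _ (hf.comp_simpleFunc (phasePow_zero (s z)))
      (hg.comp_simpleFunc (phasePow_zero (t z)))
    simpa only [norm_phasePow_rpow hr hp hsr, norm_phasePow_rpow hr' hq htr] using this
  have hA : 0 ≤ ∫ x, ‖f x‖ ^ p := integral_nonneg fun _ => by positivity
  have hB : 0 ≤ ∫ x, ‖g x‖ ^ q := integral_nonneg fun _ => by positivity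
  have key := HadamardThreeLines.norm_le_interp_of_mem_verticalClosedStrip₀₁' G (z := (θ : ℂ))
    (a := K * ((∫ x, ‖f x‖ ^ p) ^ (1 / p₀) * (∫ x, ‖g x‖ ^ q) ^ (1 / q₀)))
    (b := K * ((∫ x, ‖f x‖ ^ p) ^ (1 / p₁) * (∫ x, ‖g x‖ ^ q) ^ (1 / q₁)))
    (by simpa [HadamardThreeLines.verticalClosedStrip] using And.intro hθ₀ hθ₁)
    hGd.diffContOnCl hGb
    (fun z hz => by
      have hz0 : z.re = 0 := hz
      exact hline z hp₀ hq₀ (by simp [s, re_interpExponent, hz0])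
        (by simp [t, re_interpExponent, hz0]) h₀)
    (fun z hz => by
      have hz1 : z.re = 1 := hz
      exact hline z hp₁ hq₁ (by simp [s, re_interpExponent, hz1])
        (by simp [t, re_interpExponent, hz1]) h₁)
  have hone : ∀ {r r₀ r₁ : ℝ}, 0 < r → 1 / r = (1 - θ) / r₀ + θ / r₁ →
      interpExponent r r₀ r₁ θ = 1 := by
    intro r r₀ r₁ hr h
    have : r / r₀ * (1 - θ) + r / r₁ * θ = 1 := by
      calc r / r₀ * (1 - θ) + r / r₁ * θ = r * ((1 - θ) / r₀ + θ / r₁) := by ring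
        _ = 1 := by rw [← h]; field_simp
    unfold interpExponent
    exact_mod_cast this
  have hGθ : G θ = ∫ x, g x * convW W f x := by
    simp only [G, s, t, hone hp hpθ, hone hq hqθ, phasePow_one]
  rw [hGθ, ofReal_re] at key
  refine key.trans_eq ?_
  have hK' : K ^ (1 - θ) * K ^ θ = K := by
    rw [← Real.rpow_add_of_nonneg hK (sub_nonneg.2 hθ₁) hθ₀, sub_add_cancel, Real.rpow_one]
  rw [Real.mul_rpow hK (by positivity), Real.mul_rpow hK (by positivity),
    Real.mul_rpow (by positivity) (by positivity), Real.mul_rpow (by positivity) (by positivity)]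
  rw [← interp_rpow_mul hA hp₀ hp₁ hθ₀ hθ₁ hpθ, ← interp_rpow_mul hB hq₀ hq₁ hθ₀ hθ₁ hqθ]
  nth_rw 3 [← hK']
  ring

lemma tendsto_integral_mul_convW {N : ℕ} {W : (Fin N → ℝ) → ℝ} (hW : LocallyIntegrable W volume)
    {f g : (Fin N → ℝ) → ℂ} {u : ℕ → (Fin N → ℝ) → ℂ} (hf : IsBddSupp f) (hg : IsBddSupp g)
    (hu : ∀ n, IsBddSupp (u n)) (huf : ∀ n x, ‖u n x‖ ≤ ‖f x‖ + ‖f x‖)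
    (hlim : ∀ x, Tendsto (fun n => u n x) atTop (𝓝 (f x))) :
    Tendsto (fun n => ∫ x, u n x * convW W g x) atTop (𝓝 (∫ x, f x * convW W g x)) := by
  have hint := (hg.integrable_mul_convW hW hf).norm
  refine tendsto_integral_of_dominated_convergence _
    (fun n => (hg.integrable_mul_convW hW (hu n)).aestronglyMeasurable) (hint.add hint)
    (fun n => Eventually.of_forall fun x => ?_)
    (Eventually.of_forall fun x => (hlim x).mul_const _)
  simp only [Pi.add_apply, norm_mul]
  rw [← add_mul]
  gcongr
  exact huf n x

lemma tendsto_integral_norm_rpow {N : ℕ} {f : (Fin N → ℝ) → ℂ} {u : ℕ → (Fin N → ℝ) → ℂ} {p : ℝ}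
    (hp : 0 < p) (hf : IsBddSupp f) (hu : ∀ n, IsBddSupp (u n))
    (huf : ∀ n x, ‖u n x‖ ≤ ‖f x‖ + ‖f x‖)
    (hlim : ∀ x, Tendsto (fun n => u n x) atTop (𝓝 (f x))) :
    Tendsto (fun n => (∫ x, ‖u n x‖ ^ p) ^ (1 / p)) atTop (𝓝 ((∫ x, ‖f x‖ ^ p) ^ (1 / p))) := by
  refine Tendsto.rpow_const ?_ (Or.inr (by positivity))
  refine tendsto_integral_of_dominated_convergence (fun x => 2 ^ p * ‖f x‖ ^ p)
    (fun n => ((hu n).integrable_norm_rpow hp).aestronglyMeasurable)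
    ((hf.integrable_norm_rpow hp).const_mul _)
    (fun n => Eventually.of_forall fun x => ?_)
    (Eventually.of_forall fun x => ((hlim x).norm).rpow_const (Or.inr hp.le))
  rw [Real.norm_of_nonneg (by positivity), ← Real.mul_rpow (by norm_num) (norm_nonneg _), two_mul]
  exact Real.rpow_le_rpow (norm_nonneg _) (huf n x) hp.le

lemma IsBddSupp.exists_simpleFunc_tendsto {N : ℕ} {f : (Fin N → ℝ) → ℂ} (hf : IsBddSupp f) :
    ∃ u : ℕ → SimpleFunc (Fin N → ℝ) ℂ, (∀ n, IsBddSupp (u n)) ∧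
      (∀ n x, ‖u n x‖ ≤ ‖f x‖ + ‖f x‖) ∧ ∀ x, Tendsto (fun n => u n x) atTop (𝓝 (f x)) := by
  have hle := SimpleFunc.norm_approxOn_zero_le hf.measurable (Set.mem_univ (0 : ℂ))
  refine ⟨SimpleFunc.approxOn f hf.measurable Set.univ 0 (Set.mem_univ _), fun n => ?_,
    fun n x => hle x n, fun x => SimpleFunc.tendsto_approxOn hf.measurable _ (by simp)⟩
  obtain ⟨C, hC0, hC⟩ := hf.bdd
  exact hf.of_norm_le (SimpleFunc.measurable _)
    (fun x hx => by simpa [hx] using hle x n)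
    ⟨C + C, by positivity, fun x => (hle x n).trans (add_le_add (hC x) (hC x))⟩

/-- Riesz–Thorin interpolation for the bilinear form `(f, g) ↦ ∫ g (W ∗ f)`. -/
lemma PairBdd.interpolate {N : ℕ} {W : (Fin N → ℝ) → ℝ}
    (hW : LocallyIntegrable W volume) (hWeven : ∀ᵐ x : Fin N → ℝ, W (-x) = W x)
    {p q p₀ q₀ p₁ q₁ θ K : ℝ} (hp : 0 < p) (hq : 0 < q)
    (hp₀ : 0 < p₀) (hq₀ : 0 < q₀) (hp₁ : 0 < p₁) (hq₁ : 0 < q₁) (hθ₀ : 0 ≤ θ) (hθ₁ : θ ≤ 1)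
    (hpθ : 1 / p = (1 - θ) / p₀ + θ / p₁) (hqθ : 1 / q = (1 - θ) / q₀ + θ / q₁) (hK : 0 ≤ K)
    (h₀ : PairBdd W p₀ q₀ K) (h₁ : PairBdd W p₁ q₁ K) : PairBdd W p q K := by
  intro f g hf hg
  obtain ⟨u, hu, huf, hulim⟩ := hf.exists_simpleFunc_tendsto
  obtain ⟨v, hv, hvg, hvlim⟩ := hg.exists_simpleFunc_tendsto
  have hsimple : ∀ m, ‖∫ x, v m x * convW W f x‖ ≤
      K * ((∫ x, ‖f x‖ ^ p) ^ (1 / p) * (∫ x, ‖v m x‖ ^ q) ^ (1 / q)) := by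
    intro m
    rw [hf.integral_mul_convW_comm hW hWeven (hv m)]
    refine le_of_tendsto_of_tendsto'
      (tendsto_integral_mul_convW hW hf (hv m) hu huf hulim).norm
      (((tendsto_integral_norm_rpow hp hf hu huf hulim).mul_const _).const_mul K) fun n => ?_
    rw [(hv m).integral_mul_convW_comm hW hWeven (hu n)]
    exact PairBdd.interpolate_simpleFunc hW hp hq hp₀ hq₀ hp₁ hq₁ hθ₀ hθ₁ hpθ hqθ hK h₀ h₁
      (hu n) (hv m)
  exact le_of_tendsto_of_tendsto' (tendsto_integral_mul_convW hW hg hf hv hvg hvlim).norm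
    (((tendsto_integral_norm_rpow hq hg hv hvg hvlim).const_mul _).const_mul K) hsimple

/-- For `1 ≤ N ≤ 3`, a locally integrable even real kernel `W` lying in
`M_{2,2}(ℝ^N)` (with constant `K₂`) and `M_{3,3}(ℝ^N)` (with constant `K₃`) lies in
`M_{p,p}(ℝ^N)` for every `p ∈ [3/2, 3]`, with a constant depending only on `K₂` and `K₃`
(namely `max K₂ K₃`).  In particular, `W` satisfies condition `(W_N)` with the choice
`p₁ = q₁ = 3/2`, `p₂ = p₃ = q₂ = q₃ = s₁ = s₂ = 3`, `p₄ = q₄ = 2`. -/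
theorem statement0 {N : ℕ} (hN1 : 1 ≤ N) (hN3 : N ≤ 3)
    (W : (Fin N → ℝ) → ℝ) (hWloc : MeasureTheory.LocallyIntegrable W volume)
    (hWeven : ∀ᵐ x : Fin N → ℝ, W (-x) = W x)
    (K₂ K₃ : ℝ) (hK₂ : 0 ≤ K₂) (hK₃ : 0 ≤ K₃)
    (h22 : MemMwith W 2 2 K₂) (h33 : MemMwith W 3 3 K₃) :
    (∀ p : ℝ, 3 / 2 ≤ p → p ≤ 3 →
      MemMwith W (ENNReal.ofReal p) (ENNReal.ofReal p) (max K₂ K₃)) ∧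
    CondWnAt W (3 / 2) 3 3 2 (3 / 2) 3 3 2 3 3 := by
  set K := max K₂ K₃ with hKdef
  have hK : 0 ≤ K := hK₂.trans (le_max_left _ _)
  have c22 : (2 : ℝ).HolderConjugate 2 := .two_two
  have c33 : (3 : ℝ).HolderConjugate (3 / 2) := Real.holderConjugate_iff.2 (by norm_num)
  have e2 : ENNReal.ofReal 2 = 2 := by simp
  have e3 : ENNReal.ofReal 3 = 3 := by simp
  have b22 : PairBdd W 2 2 K := (ConvBdd.pairBdd c22 hK₂ hWloc
    (MemMwith.convBdd two_pos hWloc (by rwa [e2]))).mono (le_max_left _ _)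
  have b33 : PairBdd W 3 (3 / 2) K := (ConvBdd.pairBdd c33 hK₃ hWloc
    (MemMwith.convBdd three_pos hWloc (by rwa [e3]))).mono (le_max_right _ _)
  have upper : ∀ p q : ℝ, p.HolderConjugate q → 2 ≤ p → p ≤ 3 → PairBdd W p q K := by
    intro p q hpq h2 h3
    have hp : 0 < p := hpq.pos
    have hinv : 1 / q = 1 - 1 / p := by
      have := hpq.one_div_add_one_div
      linarith
    have hp3 : 1 / 3 ≤ 1 / p := one_div_le_one_div_of_le hp h3
    have hp2 : 1 / p ≤ 1 / 2 := one_div_le_one_div_of_le two_pos h2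
    refine PairBdd.interpolate hWloc hWeven (θ := 3 - 6 * (1 / p)) hp hpq.symm.pos two_pos
      two_pos three_pos (by norm_num) (by linarith) (by linarith) (by ring) ?_ hK b22 b33
    rw [hinv]
    ring
  have main : ∀ p : ℝ, 3 / 2 ≤ p → p ≤ 3 →
      MemMwith W (ENNReal.ofReal p) (ENNReal.ofReal p) K := by
    intro p h1 h3
    have hpq : p.HolderConjugate (p / (p - 1)) := .conjExponent (by linarith)
    have hpair : PairBdd W p (p / (p - 1)) K := by
      rcases le_total 2 p with h2 | h2
      · exact upper p _ hpq h2 h3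
      · have hpos : 0 < p - 1 := by linarith
        exact (upper _ p hpq.symm (by rw [le_div_iff₀ hpos]; linarith)
          (by rw [div_le_iff₀ hpos]; linarith)).symm hWloc hWeven
    exact (hpair.convBdd hpq hK hWloc).memMwith hpq.pos hWloc fun f => (h22 f).1
  have m33 : MemM W (ENNReal.ofReal 3) (ENNReal.ofReal 3) :=
    ⟨K, hK, main 3 (by norm_num) le_rfl⟩
  have m22 : MemM W (ENNReal.ofReal 2) (ENNReal.ofReal 2) :=
    ⟨K, hK, main 2 (by norm_num) (by norm_num)⟩
  refine ⟨main, by norm_num, by norm_num, by norm_num, by norm_num, by norm_num, by norm_num,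
    by norm_num, by norm_num, by norm_num, by norm_num, fun h => ?_, fun _ => by norm_num,
    ⟨K₂, hK₂, h22⟩, ⟨K, hK, main _ le_rfl (by norm_num)⟩, m33, m33, m22, by norm_num, by norm_num,
    by norm_num⟩
  obtain rfl : N = 3 := le_antisymm hN3 h
  norm_num
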